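/- For all S, σ, τ > 0 and r, δ ∈ ℝ, the Black–Scholes call price is differentiable in the strike with ∂C/∂K (S, σ, r, δ, K, τ) = −e^{-rτ} Φ(d₋) for all K > 0; in particular K ↦ C(S, σ, r, δ, K, τ) is strictly decreasing on (0, ∞). -/

import Mathlib

open Real Filter Set

/-- Standard normal CDF. -/
noncomputable def stdNormalCDF (x : ℝ) : ℝ :=
  (Real.sqrt (2 * Real.pi))⁻¹ * ∫ t in Set.Iic x, Real.exp (-t ^ 2 / 2)

/-- Standard normal density. -/
noncomputable def stdNormalPDF (x : ℝ) : ℝ :=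
  (Real.sqrt (2 * Real.pi))⁻¹ * Real.exp (-x ^ 2 / 2)

/-- d₊ in the Black–Scholes formula. -/
noncomputable def dPlus (S σ r δ K τ : ℝ) : ℝ :=
  (Real.log (S / K) + (r - δ) * τ) / (σ * Real.sqrt τ) + σ * Real.sqrt τ / 2

/-- d₋ in the Black–Scholes formula. -/
noncomputable def dMinus (S σ r δ K τ : ℝ) : ℝ :=
  (Real.log (S / K) + (r - δ) * τ) / (σ * Real.sqrt τ) - σ * Real.sqrt τ / 2

/-- Black–Scholes call price. -/
noncomputable def bsCall (S σ r δ K τ : ℝ) : ℝ :=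
  S * Real.exp (-δ * τ) * stdNormalCDF (dPlus S σ r δ K τ)
    - K * Real.exp (-r * τ) * stdNormalCDF (dMinus S σ r δ K τ)

lemma gauss_integrable : MeasureTheory.Integrable (fun t : ℝ => Real.exp (-t ^ 2 / 2)) := by
  have h := integrable_exp_neg_mul_sq (b := 1 / 2) (by norm_num)
  refine h.congr (Filter.Eventually.of_forall fun t => ?_)
  simp only
  congr 1
  ring

lemma cdf_pos (x : ℝ) : 0 < stdNormalCDF x := by
  unfold stdNormalCDF
  refine mul_pos (by positivity) ?_
  rw [MeasureTheory.integral_pos_iff_support_of_nonneg (fun t => (Real.exp_pos _).le)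
    gauss_integrable.integrableOn]
  have : Function.support (fun t : ℝ => Real.exp (-t ^ 2 / 2)) = Set.univ := by
    ext t
    simp
  rw [this]
  simp

lemma cdf_hasDerivAt (x : ℝ) : HasDerivAt stdNormalCDF (stdNormalPDF x) x := by
  have hc : Continuous (fun t : ℝ => Real.exp (-t ^ 2 / 2)) := by fun_prop
  have h : stdNormalCDF = fun y => (Real.sqrt (2 * Real.pi))⁻¹ *
      ((∫ t in Set.Iic (0:ℝ), Real.exp (-t ^ 2 / 2)) + ∫ t in (0:ℝ)..y, Real.exp (-t ^ 2 / 2)) := by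
    funext y
    unfold stdNormalCDF
    rw [← intervalIntegral.integral_Iic_sub_Iic gauss_integrable.integrableOn
      gauss_integrable.integrableOn]
    ring
  rw [h]
  unfold stdNormalPDF
  exact ((intervalIntegral.integral_hasDerivAt_right (hc.intervalIntegrable _ _)
    hc.stronglyMeasurable.stronglyMeasurableAtFilter hc.continuousAt).const_add _).const_mul _

lemma pdf_identity (S σ τ r δ K : ℝ) (hS : 0 < S) (hσ : 0 < σ) (hτ : 0 < τ) (hK : 0 < K) :
    S * Real.exp (-δ * τ) * stdNormalPDF (dPlus S σ r δ K τ)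
      = K * Real.exp (-r * τ) * stdNormalPDF (dMinus S σ r δ K τ) := by
  have hs : 0 < σ * Real.sqrt τ := mul_pos hσ (Real.sqrt_pos.2 hτ)
  have hSK : S = K * Real.exp (Real.log (S / K)) := by
    rw [Real.exp_log (by positivity)]
    field_simp
  unfold stdNormalPDF dPlus dMinus
  generalize Real.log (S / K) = L at *
  generalize σ * Real.sqrt τ = s at *
  subst hSK
  have : Real.exp L * Real.exp (-δ * τ) * Real.exp (-((L + (r - δ) * τ) / s + s / 2) ^ 2 / 2)
      = Real.exp (-r * τ) * Real.exp (-((L + (r - δ) * τ) / s - s / 2) ^ 2 / 2) := by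
    rw [← Real.exp_add, ← Real.exp_add, ← Real.exp_add]
    congr 1
    field_simp
    ring
  linear_combination K * (Real.sqrt (2 * Real.pi))⁻¹ * this

lemma bs_deriv (S σ τ r δ : ℝ) (hS : 0 < S) (hσ : 0 < σ) (hτ : 0 < τ) (K : ℝ) (hK : 0 < K) :
    HasDerivAt (fun K' => bsCall S σ r δ K' τ)
        (-(Real.exp (-r * τ) * stdNormalCDF (dMinus S σ r δ K τ))) K := by
  have h0 : HasDerivAt (fun K' => Real.log (S / K')) (-(1 / K)) K := by
    have h1 : HasDerivAt (fun K' => Real.log S - Real.log K') (-(1 / K)) K := by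
      simpa using (Real.hasDerivAt_log hK.ne').const_sub (Real.log S)
    refine h1.congr_of_eventuallyEq ?_
    filter_upwards [lt_mem_nhds hK] with y hy
    exact Real.log_div hS.ne' (ne_of_gt hy)
  have hb := (h0.add_const ((r - δ) * τ)).div_const (σ * Real.sqrt τ)
  have hp : HasDerivAt (fun K' => dPlus S σ r δ K' τ) (-(1 / K) / (σ * Real.sqrt τ)) K :=
    hb.add_const _
  have hm : HasDerivAt (fun K' => dMinus S σ r δ K' τ) (-(1 / K) / (σ * Real.sqrt τ)) K :=
    hb.sub_const _
  have hP := ((cdf_hasDerivAt _).comp K hp).const_mul (S * Real.exp (-δ * τ))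
  have hM := ((hasDerivAt_id K).mul_const (Real.exp (-r * τ))).mul ((cdf_hasDerivAt _).comp K hm)
  refine (hP.sub hM).congr_deriv ?_
  simp only [id, Function.comp]
  linear_combination (-(1 / K) / (σ * Real.sqrt τ)) * pdf_identity S σ τ r δ K hS hσ hτ hK

/-- The Black–Scholes call price is differentiable in the strike with derivative
`−e^{−rτ} Φ(d₋)`, hence strictly decreasing in `K` on `(0, ∞)`. -/
theorem stmt_4 (S σ τ r δ : ℝ) (hS : 0 < S) (hσ : 0 < σ) (hτ : 0 < τ) :
    (∀ K : ℝ, 0 < K →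
      HasDerivAt (fun K' => bsCall S σ r δ K' τ)
        (-(Real.exp (-r * τ) * stdNormalCDF (dMinus S σ r δ K τ))) K) ∧
    StrictAntiOn (fun K => bsCall S σ r δ K τ) (Set.Ioi 0) := by
  have hd := bs_deriv S σ τ r δ hS hσ hτ
  refine ⟨hd, strictAntiOn_of_deriv_neg (convex_Ioi 0)
    (fun K hK => (hd K hK).continuousAt.continuousWithinAt) fun K hK => ?_⟩
  rw [interior_Ioi] at hK
  rw [(hd K hK).deriv]
  exact neg_neg_of_pos (mul_pos (Real.exp_pos _) (cdf_pos _))
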